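/- Assume G is connected, G[supp μ] is not connected, and supp μ ≠ S. Let t_ℓ = ℓ^{5N} and let X = (X(t) : t ∈ ℕ) be any non-homogeneous Markov chain on S with arbitrary initial distribution whose one-step transition matrix at time t equals P^{(μ_k,G)} whenever t ∈ [t_k, t_{k+1}) with k > k̄. Then for every function f : S → ℝ, lim_{t→∞} (1/t) Σ_{m=0}^{t−1} f(X(m)) = Σ_{s∈S} f(s) μ(s) almost surely. -/

import Mathlib

open Finset Filter MeasureTheory

attribute [local instance] Classical.propDecidable

/-- `k̄ = ⌈1 / min{μ(s) : s ∈ S, μ(s) > 0}⌉`. -/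
noncomputable def suppMinCeil {N : ℕ} (μ : Fin N → ℝ) : ℕ :=
  ⌈1 / sInf (μ '' {s | 0 < μ s})⌉₊

/-- `A_k = {s ∈ S : μ(s) < 1/k}`. -/
noncomputable def Ak {N : ℕ} (μ : Fin N → ℝ) (k : ℕ) : Finset (Fin N) :=
  Finset.univ.filter fun s => μ s < 1 / (k : ℝ)

/-- `η_k`, the uniform distribution on `A_k`. -/
noncomputable def etak {N : ℕ} (μ : Fin N → ℝ) (k : ℕ) : Fin N → ℝ :=
  fun s => if s ∈ Ak μ k then 1 / ((Ak μ k).card : ℝ) else 0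

/-- `μ_k = (1/k) η_k + ((k-1)/k) μ`. -/
noncomputable def muk {N : ℕ} (μ : Fin N → ℝ) (k : ℕ) : Fin N → ℝ :=
  fun s => (1 / (k : ℝ)) * etak μ k s + (((k : ℝ) - 1) / k) * μ s

/-- The denominator appearing in the definition of the constant `p`:
`Σ_{m>l} 1_{{s^l,s^m} ∈ E} + Σ_{m<l} (ν(s^m)/ν(s^l)) 1_{{s^l,s^m} ∈ E}`. -/
noncomputable def denomP {V : Type*} [Fintype V] [LinearOrder V]
    (G : SimpleGraph V) (ν : V → ℝ) (l : V) : ℝ :=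
  (∑ m, if l < m ∧ G.Adj l m then (1 : ℝ) else 0)
    + ∑ m, if m < l ∧ G.Adj l m then ν m / ν l else 0

/-- The constant `p = min_l 1/(2 · denom(l))`. -/
noncomputable def pconst {V : Type*} [Fintype V] [LinearOrder V]
    (G : SimpleGraph V) (ν : V → ℝ) : ℝ :=
  ⨅ l, 1 / (2 * denomP G ν l)

/-- The transition matrix `P^{(ν,G)}`. -/
noncomputable def Pmat {V : Type*} [Fintype V] [LinearOrder V]
    (G : SimpleGraph V) (ν : V → ℝ) : Matrix V V ℝ :=
  Matrix.of fun l m =>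
    if l = m then 1 - pconst G ν * denomP G ν l
    else if l < m ∧ G.Adj l m then pconst G ν
    else if m < l ∧ G.Adj l m then (ν m / ν l) * pconst G ν
    else 0

/-- `X = (X(t) : t ∈ ℕ)` is a (possibly non-homogeneous) Markov chain with one-step
transition matrix `T t` at time `t` (and arbitrary initial distribution, namely the
law of `X 0`): the finite-dimensional distributions factorize as
`P(X_0 = x_0, …, X_{n+1} = x_{n+1}) = P(X_0 = x_0) ∏_{i=0}^{n} T i (x_i, x_{i+1})`. -/
def IsMarkovOn {Ω S : Type*} [MeasurableSpace Ω] (P : MeasureTheory.Measure Ω)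
    (X : ℕ → Ω → S) (T : ℕ → Matrix S S ℝ) : Prop :=
  ∀ (n : ℕ) (path : ℕ → S),
    (P {ω | ∀ i ≤ n + 1, X i ω = path i}).toReal
      = (P {ω | X 0 ω = path 0}).toReal
        * ∏ i ∈ Finset.range (n + 1), T i (path i) (path (i + 1))

/-- The process `X` is consistent with the graph `G`: with probability one,
`X(t)` and `X(t+1)` are adjacent in `G` (i.e. equal or joined by an edge). -/
def ConsistentWith {Ω V : Type*} [MeasurableSpace Ω] (P : MeasureTheory.Measure Ω)
    (X : ℕ → Ω → V) (G : SimpleGraph V) : Prop :=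
  ∀ t : ℕ, P {ω | X t ω = X (t + 1) ω ∨ G.Adj (X t ω) (X (t + 1) ω)} = 1

theorem abs_sub_le_walk_length {V : Type*} {G : SimpleGraph V} {g : V → ℝ} {d : ℝ}
    (hd : ∀ a b, G.Adj a b → |g a - g b| ≤ d) {u v : V} (p : G.Walk u v) :
    |g u - g v| ≤ p.length * d := by
  induction p with
  | nil => simp
  | @cons a b c h p ih =>
    have h1 := hd a b h
    have h2 := abs_sub_le (g a) (g b) (g c)
    rw [SimpleGraph.Walk.length_cons]
    push_cast
    linarith

theorem abs_sub_le_card_mul {V : Type*} [Fintype V] {G : SimpleGraph V} (hG : G.Connected)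
    {g : V → ℝ} {d : ℝ} (hd : ∀ a b, G.Adj a b → |g a - g b| ≤ d) (hd0 : 0 ≤ d) (u v : V) :
    |g u - g v| ≤ Fintype.card V * d := by
  classical
  obtain ⟨p, hp⟩ := hG.exists_isPath u v
  refine (abs_sub_le_walk_length hd p).trans ?_
  have := hp.length_lt
  gcongr

/-- Energy identity for a reversible matrix. -/
theorem sum_mul_sub_eq_half_energy {V : Type*} [Fintype V] (P : Matrix V V ℝ) (ν g : V → ℝ)
    (hrow : ∀ l, ∑ m, P l m = 1) (hrev : ∀ l m, ν l * P l m = ν m * P m l) :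
    2 * ∑ l, ν l * g l * (g l - ∑ m, P l m * g m)
      = ∑ l, ∑ m, ν l * P l m * (g l - g m) ^ 2 := by
  have h1 : ∑ l, ν l * g l * (g l - ∑ m, P l m * g m)
      = ∑ l, ∑ m, ν l * P l m * (g l * (g l - g m)) := by
    refine Finset.sum_congr rfl fun l _ => ?_
    have : g l = ∑ m, P l m * g l := by rw [← Finset.sum_mul, hrow, one_mul]
    calc ν l * g l * (g l - ∑ m, P l m * g m)
        = ν l * g l * (∑ m, P l m * g l - ∑ m, P l m * g m) := by rw [← this]
      _ = _ := by
          rw [← Finset.sum_sub_distrib, Finset.mul_sum]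
          exact Finset.sum_congr rfl fun m _ => by ring
  have h2 : ∑ l, ∑ m, ν l * P l m * (g l * (g l - g m))
      = ∑ l, ∑ m, ν l * P l m * (g m * (g m - g l)) := by
    rw [Finset.sum_comm]
    exact Finset.sum_congr rfl fun l _ => Finset.sum_congr rfl fun m _ => by rw [hrev]
  rw [two_mul, h1]
  nth_rewrite 2 [h2]
  simp only [← Finset.sum_add_distrib]
  exact Finset.sum_congr rfl fun l _ => Finset.sum_congr rfl fun m _ => by ring

theorem sum_mul_sub_eq_zero {V : Type*} [Fintype V] (P : Matrix V V ℝ) (ν g : V → ℝ)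
    (hrow : ∀ l, ∑ m, P l m = 1) (hrev : ∀ l m, ν l * P l m = ν m * P m l) :
    ∑ l, ν l * (g l - ∑ m, P l m * g m) = 0 := by
  simp only [mul_sub, Finset.mul_sum, Finset.sum_sub_distrib, ← mul_assoc]
  rw [sub_eq_zero, Finset.sum_comm]
  refine Finset.sum_congr rfl fun m _ => ?_
  simp only [hrev _ m, ← Finset.sum_mul, ← Finset.mul_sum, hrow, mul_one]

/-- Every edge difference is controlled by the Dirichlet energy. -/
theorem edge_sq_le_energy {V : Type*} [Fintype V] {G : SimpleGraph V}
    (P : Matrix V V ℝ) {ν : V → ℝ} (hν : ∀ v, 0 < ν v)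
    (hrow : ∀ l, ∑ m, P l m = 1) (hrev : ∀ l m, ν l * P l m = ν m * P m l)
    (hnn : ∀ l m, l ≠ m → 0 ≤ P l m) {ε : ℝ}
    (hε : ∀ l m, G.Adj l m → ε ≤ ν l * P l m) (g : V → ℝ) {a b : V} (hab : G.Adj a b) :
    ε * (g a - g b) ^ 2 ≤ 2 * ∑ l, ν l * g l * (g l - ∑ m, P l m * g m) := by
  rw [sum_mul_sub_eq_half_energy P ν g hrow hrev]
  have hterm : ∀ l m, 0 ≤ ν l * P l m * (g l - g m) ^ 2 := fun l m => by
    rcases eq_or_ne l m with rfl | h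
    · simp
    · have := hnn l m h
      have := (hν l).le
      positivity
  calc ε * (g a - g b) ^ 2 ≤ ν a * P a b * (g a - g b) ^ 2 := by
        gcongr; exact hε a b hab
    _ ≤ ∑ m, ν a * P a m * (g a - g m) ^ 2 :=
        Finset.single_le_sum (f := fun m => ν a * P a m * (g a - g m) ^ 2)
          (fun m _ => hterm a m) (Finset.mem_univ b)
    _ ≤ _ := Finset.single_le_sum (f := fun l => ∑ m, ν l * P l m * (g l - g m) ^ 2)
          (fun l _ => Finset.sum_nonneg fun m _ => hterm l m) (Finset.mem_univ a)

/-- The Poisson equation of a reversible irreducible matrix has a solution, bounded in terms of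
the smallest edge conductance. -/
theorem exists_poisson_solution {V : Type*} [Fintype V] {G : SimpleGraph V} (hG : G.Connected)
    (P : Matrix V V ℝ) {ν : V → ℝ} (hν : ∀ v, 0 < ν v) (hν1 : ∑ v, ν v = 1)
    (hrow : ∀ l, ∑ m, P l m = 1) (hrev : ∀ l m, ν l * P l m = ν m * P m l)
    (hnn : ∀ l m, l ≠ m → 0 ≤ P l m) {ε : ℝ} (hε0 : 0 < ε)
    (hε : ∀ l m, G.Adj l m → ε ≤ ν l * P l m) {h : V → ℝ} (hh : ∑ v, ν v * h v = 0)
    {H : ℝ} (hH : ∀ v, |h v| ≤ H) :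
    ∃ g : V → ℝ, (∀ l, g l - ∑ m, P l m * g m = h l) ∧
      ∀ l, |g l| ≤ 2 * (Fintype.card V : ℝ) ^ 2 * H / ε := by
  obtain ⟨v₀⟩ := hG.nonempty
  have hH0 : 0 ≤ H := (abs_nonneg _).trans (hH v₀)
  let L : (V → ℝ) →ₗ[ℝ] (V → ℝ) :=
    { toFun := fun g l => g l - ∑ m, P l m * g m + ∑ m, ν m * g m
      map_add' := fun g g' => by
        ext l
        simp only [Pi.add_apply, mul_add, Finset.sum_add_distrib]
        ring
      map_smul' := fun c g => by
        ext l
        simp only [Pi.smul_apply, smul_eq_mul, RingHom.id_apply, mul_left_comm _ c,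
          ← Finset.mul_sum]
        ring }
  have hL : ∀ g l, L g l = g l - ∑ m, P l m * g m + ∑ m, ν m * g m := fun _ _ => rfl
  have hνL : ∀ g, ∑ l, ν l * L g l = ∑ m, ν m * g m := fun g => by
    simp only [hL, mul_add, Finset.sum_add_distrib, ← Finset.sum_mul, hν1, one_mul]
    rw [sum_mul_sub_eq_zero P ν g hrow hrev, zero_add]
  have hinj : Function.Injective L := by
    rw [← LinearMap.ker_eq_bot, LinearMap.ker_eq_bot']
    intro g hg
    have h0 : ∑ m, ν m * g m = 0 := by rw [← hνL g, hg]; simp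
    have hP : ∀ l, g l - ∑ m, P l m * g m = 0 := fun l => by
      have := hL g l
      rw [hg, h0, add_zero] at this
      exact this.symm
    have hedge : ∀ a b, G.Adj a b → |g a - g b| ≤ 0 := fun a b hab => by
      have := edge_sq_le_energy P hν hrow hrev hnn hε g hab
      simp only [hP, mul_zero, Finset.sum_const_zero] at this
      have h2 : (g a - g b) ^ 2 ≤ 0 := nonpos_of_mul_nonpos_right this hε0
      rw [pow_eq_zero_iff two_ne_zero |>.1 (le_antisymm h2 (sq_nonneg _)), abs_zero]
    have hconst : ∀ u v, g u = g v := fun u v => by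
      have := abs_sub_le_card_mul hG hedge le_rfl u v
      rw [mul_zero] at this
      exact sub_eq_zero.1 (abs_nonpos_iff.1 this)
    ext l
    simp only [hconst _ l, ← Finset.sum_mul, hν1, one_mul] at h0
    exact h0
  obtain ⟨g₀, hg₀⟩ := (LinearMap.injective_iff_surjective.1 hinj) h
  have h0 : ∑ m, ν m * g₀ m = 0 := by rw [← hνL g₀, hg₀, hh]
  set g : V → ℝ := fun v => g₀ v - g₀ v₀ with hgdef
  have hg : ∀ l, g l - ∑ m, P l m * g m = h l := by
    intro l
    have := hL g₀ l
    rw [hg₀, h0, add_zero] at this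
    simp only [hgdef, this, mul_sub, Finset.sum_sub_distrib, ← Finset.sum_mul, hrow]
    ring
  refine ⟨g, hg, ?_⟩
  obtain ⟨w, -, hw⟩ := Finset.exists_max_image Finset.univ (fun v => |g v|) ⟨v₀, Finset.mem_univ _⟩
  set R := |g w| with hR
  have hR0 : 0 ≤ R := abs_nonneg _
  have hE : ∑ l, ν l * g l * (g l - ∑ m, P l m * g m) ≤ H * R := by
    calc _ ≤ ∑ l, ν l * (H * R) := by
          refine Finset.sum_le_sum fun l _ => ?_
          rw [hg, mul_assoc]
          refine mul_le_mul_of_nonneg_left ?_ (hν l).le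
          calc g l * h l ≤ |g l * h l| := le_abs_self _
            _ = |h l| * |g l| := by rw [abs_mul, mul_comm]
            _ ≤ H * R := mul_le_mul (hH l) (hw l (Finset.mem_univ _)) (abs_nonneg _) hH0
      _ = H * R := by rw [← Finset.sum_mul, hν1, one_mul]
  have hedge : ∀ a b, G.Adj a b → |g a - g b| ≤ √(2 * (H * R) / ε) := fun a b hab => by
    refine Real.abs_le_sqrt ?_
    rw [le_div_iff₀ hε0, mul_comm]
    exact (edge_sq_le_energy P hν hrow hrev hnn hε g hab).trans (by linarith)
  have hosc := abs_sub_le_card_mul hG hedge (Real.sqrt_nonneg _) w v₀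
  have hgv : g v₀ = 0 := by simp [hgdef]
  rw [hgv, sub_zero, ← hR] at hosc
  have hsq : R ^ 2 ≤ (Fintype.card V : ℝ) ^ 2 * (2 * (H * R) / ε) := by
    calc R ^ 2 ≤ ((Fintype.card V : ℝ) * √(2 * (H * R) / ε)) ^ 2 := by gcongr
      _ = _ := by rw [mul_pow, Real.sq_sqrt (by positivity)]
  intro l
  refine (hw l (Finset.mem_univ _)).trans ?_
  change R ≤ _
  rcases hR0.eq_or_lt with h | h
  · rw [← h]; positivity
  · refine le_of_mul_le_mul_right (a := R) ?_ h
    calc R * R = R ^ 2 := by ring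
      _ ≤ _ := hsq
      _ = _ := by ring

section TransitionMatrix

variable {V : Type*} [Fintype V] [LinearOrder V] {G : SimpleGraph V} {ν : V → ℝ}

theorem Pmat_eq_add (l m : V) :
    Pmat G ν l m = (if l = m then 1 - pconst G ν * denomP G ν l else 0)
      + pconst G ν * (if l < m ∧ G.Adj l m then 1 else 0)
      + pconst G ν * (if m < l ∧ G.Adj l m then ν m / ν l else 0) := by
  rw [Pmat, Matrix.of_apply]
  rcases lt_trichotomy l m with h | h | h
  · simp [h, h.ne, h.not_gt]
  · simp [h]
  · simp [h, h.ne', h.not_gt, mul_comm]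

theorem sum_Pmat_row (l : V) : ∑ m, Pmat G ν l m = 1 := by
  simp only [Pmat_eq_add, Finset.sum_add_distrib, ← Finset.mul_sum, Finset.sum_ite_eq,
    Finset.mem_univ, if_true]
  rw [add_assoc, ← mul_add, ← denomP]
  ring

theorem mul_Pmat_of_adj (hν : ∀ v, 0 < ν v) {l m : V} (h : G.Adj l m) :
    ν l * Pmat G ν l m = pconst G ν * ν (min l m) := by
  rw [Pmat, Matrix.of_apply]
  have := (hν l).ne'
  rcases lt_or_gt_of_ne h.ne with hlm | hlm
  · simp [h, hlm, hlm.ne, min_eq_left hlm.le, mul_comm]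
  · simp only [h, hlm, hlm.ne', hlm.not_gt, min_eq_right hlm.le, and_true, if_false, if_true]
    field_simp

theorem Pmat_eq_zero {l m : V} (hlm : l ≠ m) (h : ¬ G.Adj l m) : Pmat G ν l m = 0 := by
  simp [Pmat, hlm, h]

theorem Pmat_reversible (hν : ∀ v, 0 < ν v) (l m : V) :
    ν l * Pmat G ν l m = ν m * Pmat G ν m l := by
  by_cases h : G.Adj l m
  · rw [mul_Pmat_of_adj hν h, mul_Pmat_of_adj hν h.symm, min_comm]
  · rcases eq_or_ne l m with rfl | hlm
    · rfl
    · rw [Pmat_eq_zero hlm h, Pmat_eq_zero hlm.symm fun h' => h h'.symm, mul_zero, mul_zero]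

theorem denomP_pos [Nontrivial V] (hG : G.Connected) (hν : ∀ v, 0 < ν v) (l : V) :
    0 < denomP G ν l := by
  obtain ⟨m, hm⟩ := hG.preconnected.exists_adj_of_nontrivial l
  have hdiv : ∀ m, 0 < ν m / ν l := fun m => div_pos (hν m) (hν l)
  have h1 : ∀ m, (0 : ℝ) ≤ if l < m ∧ G.Adj l m then (1 : ℝ) else 0 := fun m => by
    split_ifs <;> norm_num
  have h2 : ∀ m, (0 : ℝ) ≤ if m < l ∧ G.Adj l m then ν m / ν l else 0 := fun m => by
    split_ifs
    exacts [(hdiv m).le, le_rfl]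
  rw [denomP, ← Finset.sum_add_distrib]
  refine Finset.sum_pos' (fun m _ => add_nonneg (h1 m) (h2 m)) ⟨m, Finset.mem_univ _, ?_⟩
  rcases lt_or_gt_of_ne hm.ne with h | h
  · refine add_pos_of_pos_of_nonneg ?_ (h2 m)
    simp [h, hm]
  · refine add_pos_of_nonneg_of_pos (h1 m) ?_
    simp [h, hm, hdiv m]

theorem denomP_le {δ : ℝ} (hδ : 0 < δ) (hδν : ∀ v, δ ≤ ν v) (hν1 : ∀ v, ν v ≤ 1) (l : V) :
    denomP G ν l ≤ Fintype.card V / δ := by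
  have hδ1 : δ ≤ 1 := (hδν l).trans (hν1 l)
  have hone : 1 ≤ 1 / δ := by rwa [le_div_iff₀ hδ, one_mul]
  have hdiv : ∀ m, ν m / ν l ≤ 1 / δ := fun m =>
    div_le_div₀ zero_le_one (hν1 m) hδ (hδν l)
  rw [denomP, ← Finset.sum_add_distrib]
  calc _ ≤ ∑ _m : V, 1 / δ := by
        refine Finset.sum_le_sum fun m _ => ?_
        by_cases h1 : l < m ∧ G.Adj l m
        · simp only [h1, h1.1.not_gt, and_self, false_and, if_true, if_false, add_zero]
          exact hone
        · rw [if_neg h1, zero_add]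
          split_ifs
          exacts [hdiv m, by positivity]
    _ = _ := by simp [div_eq_mul_inv]

theorem le_pconst [Nontrivial V] (hG : G.Connected) {δ : ℝ} (hδ : 0 < δ)
    (hδν : ∀ v, δ ≤ ν v) (hν1 : ∀ v, ν v ≤ 1) :
    δ / (2 * Fintype.card V) ≤ pconst G ν := by
  refine le_ciInf fun l => ?_
  have hd := denomP_pos hG (fun v => hδ.trans_le (hδν v)) l
  have hle := denomP_le (G := G) hδ hδν hν1 l
  have hN : (0 : ℝ) < Fintype.card V := by exact_mod_cast Fintype.card_pos
  rw [le_div_iff₀ hδ] at hle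
  rw [div_le_div_iff₀ (by positivity) (by positivity)]
  linarith

/-- The Poisson equation for `P^{(ν,G)}` has a solution of polynomial size in `1 / min ν`. -/
theorem exists_poisson_solution_Pmat [Nontrivial V] (hG : G.Connected) {δ : ℝ} (hδ : 0 < δ)
    (hδν : ∀ v, δ ≤ ν v) (hν1 : ∑ v, ν v = 1) {h : V → ℝ} (hh : ∑ v, ν v * h v = 0)
    {H : ℝ} (hH : ∀ v, |h v| ≤ H) :
    ∃ g : V → ℝ, (∀ l, g l - ∑ m, Pmat G ν l m * g m = h l) ∧
      ∀ l, |g l| ≤ 4 * (Fintype.card V : ℝ) ^ 3 * H / δ ^ 2 := by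
  have hν : ∀ v, 0 < ν v := fun v => hδ.trans_le (hδν v)
  have hνle : ∀ v, ν v ≤ 1 := fun v => by
    rw [← hν1]
    exact Finset.single_le_sum (fun v _ => (hν v).le) (Finset.mem_univ v)
  have hN : (0 : ℝ) < Fintype.card V := by exact_mod_cast Fintype.card_pos
  have hp := le_pconst hG hδ hδν hνle
  have hp0 : 0 < pconst G ν := lt_of_lt_of_le (by positivity) hp
  have hε : ∀ l m, G.Adj l m → δ ^ 2 / (2 * Fintype.card V) ≤ ν l * Pmat G ν l m :=
    fun l m hlm => by
      rw [mul_Pmat_of_adj hν hlm]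
      calc δ ^ 2 / (2 * Fintype.card V) = δ / (2 * Fintype.card V) * δ := by ring
        _ ≤ _ := by gcongr; exact hδν _
  have hnn : ∀ l m, l ≠ m → 0 ≤ Pmat G ν l m := fun l m hlm => by
    by_cases h : G.Adj l m
    · refine (mul_nonneg_iff_of_pos_left (hν l)).1 ?_
      exact le_trans (by positivity) (hε l m h)
    · rw [Pmat_eq_zero hlm h]
  obtain ⟨g, hg, hgb⟩ := exists_poisson_solution hG (Pmat G ν) hν hν1 sum_Pmat_row
    (Pmat_reversible hν) hnn (by positivity) hε hh hH
  refine ⟨g, hg, fun l => (hgb l).trans_eq ?_⟩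
  field_simp
  ring

end TransitionMatrix

section Approximation

variable {N : ℕ} {μ : Fin N → ℝ} {k : ℕ}

theorem one_le_mul_of_suppMinCeil_lt (hk : suppMinCeil μ < k) {s : Fin N} (hs : 0 < μ s) :
    1 ≤ μ s * ((k : ℝ) - 1) := by
  have hfin : (μ '' {s | 0 < μ s}).Finite := Set.toFinite _
  have hne : (μ '' {s | 0 < μ s}).Nonempty := ⟨μ s, s, hs, rfl⟩
  obtain ⟨z, hz, hzm⟩ := hne.csInf_mem hfin
  have hz' : 0 < μ z := hz
  have hle : μ z ≤ μ s := hzm ▸ csInf_le hfin.bddBelow ⟨s, hs, rfl⟩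
  have h1 : 1 / μ z ≤ suppMinCeil μ := by
    rw [hzm]
    exact Nat.le_ceil _
  have h2 : (suppMinCeil μ : ℝ) + 1 ≤ k := by exact_mod_cast hk
  rw [div_le_iff₀ hz'] at h1
  have hk0 : (0 : ℝ) ≤ suppMinCeil μ := Nat.cast_nonneg _
  nlinarith

theorem mem_Ak_iff (hμ0 : ∀ s, 0 ≤ μ s) (hk : suppMinCeil μ < k) {s : Fin N} :
    s ∈ Ak μ k ↔ μ s = 0 := by
  have hk0 : (0 : ℝ) < k := by exact_mod_cast (Nat.zero_le _).trans_lt hk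
  simp only [Ak, Finset.mem_filter, Finset.mem_univ, true_and, lt_div_iff₀ hk0]
  constructor
  · intro h
    by_contra hs
    have := one_le_mul_of_suppMinCeil_lt hk (lt_of_le_of_ne (hμ0 s) (Ne.symm hs))
    linarith [hμ0 s]
  · intro h
    simp [h]

theorem etak_nonneg (s : Fin N) : 0 ≤ etak μ k s := by
  rw [etak]
  split_ifs <;> positivity

theorem etak_le_one (s : Fin N) : etak μ k s ≤ 1 := by
  rw [etak]
  split_ifs with h
  · have : (1 : ℝ) ≤ (Ak μ k).card := by exact_mod_cast Finset.card_pos.2 ⟨s, h⟩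
    rw [div_le_one (by linarith)]
    exact this
  · exact zero_le_one

theorem sum_etak (hA : (Ak μ k).Nonempty) : ∑ s, etak μ k s = 1 := by
  have : ((Ak μ k).card : ℝ) ≠ 0 := by exact_mod_cast hA.card_pos.ne'
  simp only [etak, Finset.sum_ite_mem, Finset.univ_inter, Finset.sum_const, nsmul_eq_mul]
  field_simp

theorem sum_muk (hμ1 : ∑ s, μ s = 1) (hk : k ≠ 0) (hA : (Ak μ k).Nonempty) :
    ∑ s, muk μ k s = 1 := by
  have : (k : ℝ) ≠ 0 := by exact_mod_cast hk
  simp only [muk, Finset.sum_add_distrib, ← Finset.mul_sum, hμ1, sum_etak hA]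
  field_simp
  ring

theorem le_muk (hμ0 : ∀ s, 0 ≤ μ s) (hk : suppMinCeil μ < k) (s : Fin N) :
    1 / ((k : ℝ) * N) ≤ muk μ k s := by
  have hk0 : (0 : ℝ) < k := by exact_mod_cast (Nat.zero_le _).trans_lt hk
  have hN : (1 : ℝ) ≤ N := by exact_mod_cast (Nat.zero_le _).trans_lt s.2
  rcases (hμ0 s).eq_or_lt with hs | hs
  · have hmem : s ∈ Ak μ k := (mem_Ak_iff hμ0 hk).2 hs.symm
    have h1 : (0 : ℝ) < (Ak μ k).card := by exact_mod_cast Finset.card_pos.2 ⟨s, hmem⟩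
    have h2 : ((Ak μ k).card : ℝ) ≤ N := by
      exact_mod_cast (Finset.card_le_univ _).trans_eq (Fintype.card_fin N)
    rw [muk, etak, if_pos hmem, ← hs, mul_zero, add_zero, ← one_div_mul_one_div]
    gcongr
  · have h1 := one_le_mul_of_suppMinCeil_lt hk hs
    have h2 : 0 ≤ 1 / (k : ℝ) * etak μ k s := mul_nonneg (by positivity) (etak_nonneg s)
    calc 1 / ((k : ℝ) * N) ≤ 1 / (k : ℝ) := by
          gcongr
          exact le_mul_of_one_le_right hk0.le hN
      _ ≤ μ s * ((k : ℝ) - 1) / k := by gcongr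
      _ = ((k : ℝ) - 1) / k * μ s := by ring
      _ ≤ _ := by rw [muk]; linarith

theorem tendsto_muk (s : Fin N) : Tendsto (fun k => muk μ k s) atTop (nhds (μ s)) := by
  have h1 : Tendsto (fun k : ℕ => 1 / (k : ℝ) * etak μ k s) atTop (nhds 0) := by
    refine squeeze_zero (fun k => mul_nonneg (by positivity) (etak_nonneg s))
      (fun k => ?_) tendsto_one_div_atTop_nhds_zero_nat
    exact mul_le_of_le_one_right (by positivity) (etak_le_one s)
  have h2 : Tendsto (fun k : ℕ => (1 - 1 / (k : ℝ)) * μ s) atTop (nhds ((1 - 0) * μ s)) :=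
    (tendsto_const_nhds.sub tendsto_one_div_atTop_nhds_zero_nat).mul_const _
  have h3 := h1.add h2
  rw [sub_zero, one_mul, zero_add] at h3
  refine h3.congr' ?_
  filter_upwards [eventually_ne_atTop 0] with k hk
  have : (k : ℝ) ≠ 0 := by exact_mod_cast hk
  rw [muk, sub_div, div_self this]

end Approximation

section Deterministic

theorem tendsto_nthRoot_atTop {d : ℕ} (hd : d ≠ 0) : Tendsto (Nat.nthRoot d) atTop atTop := by
  refine tendsto_atTop.2 fun b => ?_
  filter_upwards [eventually_ge_atTop (b ^ d)] with n hn
  exact (Nat.le_nthRoot_iff hd).2 hn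

theorem monotone_nthRoot {d : ℕ} (hd : d ≠ 0) : Monotone (Nat.nthRoot d) := fun _ _ hab =>
  (Nat.le_nthRoot_iff hd).2 (((Nat.le_nthRoot_iff hd).1 le_rfl).trans hab)

theorem abs_sub_le_of_abs_sub_succ_le {S : ℕ → ℝ} {C : ℝ} (hS : ∀ n, |S (n + 1) - S n| ≤ C)
    {a b : ℕ} (hab : a ≤ b) : |S b - S a| ≤ C * ((b : ℝ) - a) := by
  induction b, hab using Nat.le_induction with
  | base => simp
  | succ n hn ih =>
    have h1 := abs_sub_le (S (n + 1)) (S n) (S a)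
    have h2 := hS n
    push_cast
    linarith

/-- A sequence with bounded increments which is `o(n)` along the cubes is `o(n)`. -/
theorem tendsto_div_of_tendsto_div_cube {S : ℕ → ℝ} {C : ℝ}
    (hS : ∀ n, |S (n + 1) - S n| ≤ C)
    (h : Tendsto (fun j : ℕ => S (j ^ 3) / ((j ^ 3 : ℕ) : ℝ)) atTop (nhds 0)) :
    Tendsto (fun n : ℕ => S n / n) atTop (nhds 0) := by
  have hC : 0 ≤ C := (abs_nonneg _).trans (hS 0)
  have hroot := tendsto_nthRoot_atTop (d := 3) (by norm_num)
  have h1 := (h.abs.comp hroot).add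
    ((tendsto_const_nhds (x := 7 * C)).mul (tendsto_one_div_atTop_nhds_zero_nat.comp hroot))
  rw [abs_zero, mul_zero, add_zero] at h1
  refine squeeze_zero_norm' ?_ h1
  filter_upwards [hroot.eventually_ge_atTop 1] with n hn
  set j := Nat.nthRoot 3 n with hj
  have hle : j ^ 3 ≤ n := (Nat.le_nthRoot_iff (by norm_num)).1 le_rfl
  have hlt : n < (j + 1) ^ 3 := Nat.lt_pow_nthRoot_add_one (by norm_num) n
  have hj1 : (1 : ℝ) ≤ j := by exact_mod_cast hn
  have hle' : (j : ℝ) ^ 3 ≤ n := by exact_mod_cast hle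
  have hlt' : (n : ℝ) ≤ ((j : ℝ) + 1) ^ 3 := by exact_mod_cast hlt.le
  have hdiff := abs_sub_le_of_abs_sub_succ_le hS hle
  have hn0 : (n : ℝ) - (j ^ 3 : ℕ) ≤ 7 * (j : ℝ) ^ 2 := by push_cast; nlinarith
  have hSn : |S n| ≤ |S (j ^ 3)| + 7 * C * (j : ℝ) ^ 2 := by
    have h2 := abs_sub_abs_le_abs_sub (S n) (S (j ^ 3))
    have h3 := mul_le_mul_of_nonneg_left hn0 hC
    linarith
  have hj3 : (0 : ℝ) < (j : ℝ) ^ 3 := by positivity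
  simp only [Function.comp_apply, ← hj, Real.norm_eq_abs, abs_div, Nat.abs_cast]
  calc |S n| / n ≤ (|S (j ^ 3)| + 7 * C * (j : ℝ) ^ 2) / (j : ℝ) ^ 3 := by gcongr
    _ = _ := by
      push_cast
      field_simp

/-- Summation by parts for a sum whose summand depends on the time only through a monotone
sequence of block indices. -/
theorem abs_sum_block_sub_le {S : Type*} {g : ℕ → S → ℝ} {C : ℝ} (hC : 0 ≤ C)
    (hg : ∀ k s, |g k s| ≤ C * (k : ℝ) ^ 2) {K : ℕ → ℕ} (hK : Monotone K) (x : ℕ → S) (t : ℕ) :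
    |∑ m ∈ Finset.range t, (g (K m) (x m) - g (K m) (x (m + 1)))| ≤ 3 * C * (K t : ℝ) ^ 3 := by
  have hcube : ∀ k : ℕ, (k : ℝ) ^ 2 ≤ (k : ℝ) ^ 3 := fun k => by
    rcases k.eq_zero_or_pos with rfl | hk
    · norm_num
    · exact_mod_cast Nat.pow_le_pow_right hk (by norm_num)
  have key : |∑ m ∈ Finset.range t, (g (K m) (x m) - g (K m) (x (m + 1))) + g (K t) (x t)|
      ≤ 2 * C * (K t : ℝ) ^ 3 := by
    induction t with
    | zero =>
      have h1 := hg (K 0) (x 0)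
      have h2 := mul_le_mul_of_nonneg_left (hcube (K 0)) hC
      have h3 : 0 ≤ C * (K 0 : ℝ) ^ 3 := by positivity
      simp only [Finset.range_zero, Finset.sum_empty, zero_add]
      linarith
    | succ t ih =>
      have hstep : |g (K (t + 1)) (x (t + 1)) - g (K t) (x (t + 1))|
          ≤ 2 * C * ((K (t + 1) : ℝ) ^ 3 - (K t : ℝ) ^ 3) := by
        rcases (hK t.le_succ).eq_or_lt with h | h
        · simp [h]
        · have h1 := hg (K (t + 1)) (x (t + 1))
          have h2 := hg (K t) (x (t + 1))
          have h3 := abs_sub (g (K (t + 1)) (x (t + 1))) (g (K t) (x (t + 1)))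
          have h4 : (K t : ℝ) + 1 ≤ K (t + 1) := by exact_mod_cast h
          have h0 : (0 : ℝ) ≤ K t := Nat.cast_nonneg _
          set a : ℝ := (K t : ℝ)
          set b : ℝ := (K (t + 1) : ℝ)
          have h5 : a ^ 2 + b ^ 2 ≤ 2 * (b ^ 3 - a ^ 3) := by
            have h6 : a ^ 2 + b ^ 2 ≤ 2 * (b ^ 2 + b * a + a ^ 2) := by nlinarith
            have h7 : 0 ≤ b ^ 2 + b * a + a ^ 2 := by nlinarith
            nlinarith
          have h8 := mul_le_mul_of_nonneg_left h5 hC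
          linarith
      have h1 := abs_add_le
        (∑ m ∈ Finset.range t, (g (K m) (x m) - g (K m) (x (m + 1))) + g (K t) (x t))
        (g (K (t + 1)) (x (t + 1)) - g (K t) (x (t + 1)))
      rw [Finset.sum_range_succ]
      calc _ = _ := by congr 1; ring
        _ ≤ _ := h1
        _ ≤ _ := by linarith
  have h1 := hg (K t) (x t)
  have h2 := mul_le_mul_of_nonneg_left (hcube (K t)) hC
  have h3 := abs_sub
    (∑ m ∈ Finset.range t, (g (K m) (x m) - g (K m) (x (m + 1))) + g (K t) (x t)) (g (K t) (x t))
  rw [add_sub_cancel_right] at h3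
  linarith

end Deterministic

section Probability

variable {Ω : Type*} [MeasurableSpace Ω] {P : Measure Ω}

theorem integrable_comp_of_finite [IsFiniteMeasure P] {E : Type*} [Finite E]
    [MeasurableSpace E] [MeasurableSingletonClass E] {Z : Ω → E} (hZ : Measurable Z)
    (Ψ : E → ℝ) : Integrable (fun ω => Ψ (Z ω)) P :=
  (Integrable.of_finite (μ := P.map Z) (f := Ψ)).comp_measurable hZ

theorem ae_tendsto_zero_of_summable_integral_sq {Z : ℕ → Ω → ℝ} {c : ℕ → ℝ}
    (hint : ∀ j, Integrable (fun ω => Z j ω ^ 2) P) (hc : ∀ j, ∫ ω, Z j ω ^ 2 ∂P ≤ c j)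
    (hsum : Summable c) : ∀ᵐ ω ∂P, Tendsto (fun j => Z j ω) atTop (nhds 0) := by
  have hmeas : ∀ j, AEMeasurable (fun ω => ENNReal.ofReal (Z j ω ^ 2)) P := fun j =>
    (hint j).aemeasurable.ennreal_ofReal
  have hfin : ∫⁻ ω, ∑' j, ENNReal.ofReal (Z j ω ^ 2) ∂P ≠ ⊤ := by
    rw [lintegral_tsum hmeas]
    refine ne_top_of_le_ne_top hsum.tsum_ofReal_ne_top (ENNReal.tsum_le_tsum fun j => ?_)
    rw [← ofReal_integral_eq_lintegral_ofReal (hint j) (ae_of_all _ fun ω => sq_nonneg _)]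
    exact ENNReal.ofReal_le_ofReal (hc j)
  filter_upwards [ae_lt_top' (AEMeasurable.tsum hmeas) hfin] with ω hω
  have h1 := ENNReal.tendsto_atTop_zero_of_tsum_ne_top hω.ne
  have h2 := (ENNReal.tendsto_toReal ENNReal.zero_ne_top).comp h1
  have h3 : Tendsto (fun j => Z j ω ^ 2) atTop (nhds 0) := by
    refine h2.congr fun j => ?_
    exact ENNReal.toReal_ofReal (sq_nonneg _)
  have h4 := (Real.continuous_sqrt.tendsto 0).comp h3
  rw [Real.sqrt_zero] at h4
  refine (tendsto_zero_iff_abs_tendsto_zero _).2 (h4.congr fun j => ?_)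
  exact Real.sqrt_sq_eq_abs _

variable {S : Type*} {X : ℕ → Ω → S} {T : ℕ → Matrix S S ℝ}

theorem IsMarkovOn.real_path_succ (hM : IsMarkovOn P X T) (t : ℕ) (x : ℕ → S) :
    P.real {ω | ∀ i ≤ t + 1, X i ω = x i}
      = P.real {ω | ∀ i ≤ t, X i ω = x i} * T t (x t) (x (t + 1)) := by
  rw [Measure.real, Measure.real, hM t x]
  cases t with
  | zero => simp
  | succ t => rw [hM t x, Finset.prod_range_succ _ (t + 1), mul_assoc]

variable [Fintype S] [MeasurableSpace S] [MeasurableSingletonClass S] [IsFiniteMeasure P]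

/-- The increments `φ(X_t, X_{t+1})` with `∑ y, T t x y * φ x y = 0` are orthogonal to the past. -/
theorem IsMarkovOn.integral_past_mul_eq_zero (hM : IsMarkovOn P X T) (hX : ∀ t, Measurable (X t))
    (t : ℕ) {φ : S → S → ℝ} (hφ : ∀ x, ∑ y, T t x y * φ x y = 0)
    (Φ : (Fin (t + 1) → S) → ℝ) :
    ∫ ω, Φ (fun i => X i ω) * φ (X t ω) (X (t + 1) ω) ∂P = 0 := by
  set Z : Ω → (Fin (t + 1) → S) × S := fun ω => (fun i => X i ω, X (t + 1) ω) with hZdef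
  have hZ : Measurable Z := Measurable.prodMk (measurable_pi_lambda _ fun i => hX i) (hX _)
  set Ψ : (Fin (t + 1) → S) × S → ℝ := fun z => Φ z.1 * φ (z.1 (Fin.last t)) z.2 with hΨ
  have h1 : ∫ ω, Φ (fun i => X i ω) * φ (X t ω) (X (t + 1) ω) ∂P = ∫ z, Ψ z ∂(P.map Z) := by
    rw [integral_map hZ.aemeasurable Integrable.of_finite.aestronglyMeasurable]
    simp [hΨ, hZdef]
  rw [h1, integral_fintype Integrable.of_finite, Fintype.sum_prod_type]
  refine Finset.sum_eq_zero fun y _ => ?_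
  have hreal : ∀ s, (P.map Z).real {(y, s)}
      = P.real {ω | ∀ i : Fin (t + 1), X i ω = y i} * T t (y (Fin.last t)) s := fun s => by
    have h2 := hM.real_path_succ t (fun i => if h : i < t + 1 then y ⟨i, h⟩ else s)
    rw [map_measureReal_apply hZ (measurableSet_singleton _)]
    convert h2 using 2
    · ext ω
      simp only [hZdef, Set.mem_preimage, Set.mem_singleton_iff, Prod.mk.injEq, funext_iff,
        Set.mem_ofPred_eq]
      constructor
      · rintro ⟨ha, hb⟩ i hi
        split_ifs with h
        · exact ha ⟨i, h⟩
        · rw [← hb]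
          congr 1
          omega
      · intro h
        refine ⟨fun i => ?_, ?_⟩
        · simpa [Nat.le_of_lt_succ i.2] using h i (Nat.le_succ_of_le (Nat.le_of_lt_succ i.2))
        · simpa using h (t + 1) le_rfl
    · congr 1
      ext ω
      simp only [Set.mem_ofPred_eq]
      constructor
      · intro h i hi
        simpa [Nat.lt_succ_of_le hi] using h ⟨i, Nat.lt_succ_of_le hi⟩
      · intro h i
        simpa [Nat.le_of_lt_succ i.2] using h i (Nat.le_of_lt_succ i.2)
    · simp [Fin.last]
  calc ∑ s, (P.map Z).real {(y, s)} • Ψ (y, s)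
      = P.real {ω | ∀ i : Fin (t + 1), X i ω = y i} * Φ y *
          ∑ s, T t (y (Fin.last t)) s * φ (y (Fin.last t)) s := by
        rw [Finset.mul_sum]
        refine Finset.sum_congr rfl fun s _ => ?_
        rw [hreal, smul_eq_mul]
        simp only [hΨ]
        ring
    _ = 0 := by rw [hφ, mul_zero]

theorem integrable_sq_sum_increments (hX : ∀ t, Measurable (X t)) (φ : ℕ → S → S → ℝ) (t : ℕ) :
    Integrable (fun ω => (∑ i ∈ Finset.range t, φ i (X i ω) (X (i + 1) ω)) ^ 2) P := by
  have h := integrable_comp_of_finite (P := P)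
    (Z := fun ω (i : Fin (t + 1)) => X i ω) (measurable_pi_lambda _ fun i => hX i)
    (fun y => (∑ i : Fin t, φ i (y i.castSucc) (y i.succ)) ^ 2)
  simpa only [Finset.sum_range, Fin.val_castSucc, Fin.val_succ] using h

theorem IsMarkovOn.integral_sq_sum_increments_le (hM : IsMarkovOn P X T)
    (hX : ∀ t, Measurable (X t)) {φ : ℕ → S → S → ℝ}
    (hφ : ∀ t x, ∑ y, T t x y * φ t x y = 0) {B : ℕ → ℝ} (hB : ∀ t x y, |φ t x y| ≤ B t) (t : ℕ) :
    ∫ ω, (∑ i ∈ Finset.range t, φ i (X i ω) (X (i + 1) ω)) ^ 2 ∂P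
      ≤ P.real Set.univ * ∑ i ∈ Finset.range t, B i ^ 2 := by
  induction t with
  | zero => simp
  | succ t ih =>
    set M : Ω → ℝ := fun ω => ∑ i ∈ Finset.range t, φ i (X i ω) (X (i + 1) ω) with hMdef
    set D : Ω → ℝ := fun ω => φ t (X t ω) (X (t + 1) ω) with hDdef
    have hcross : ∫ ω, M ω * D ω ∂P = 0 := by
      have := hM.integral_past_mul_eq_zero hX t (hφ t)
        (fun y => ∑ i : Fin t, φ i (y i.castSucc) (y i.succ))
      simpa only [hMdef, hDdef, Finset.sum_range, Fin.val_castSucc, Fin.val_succ] using this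
    have hMD : Integrable (fun ω => M ω * D ω) P := by
      have h := integrable_comp_of_finite (P := P)
        (Z := fun ω => ((fun i => X i ω : Fin (t + 1) → S), X t ω, X (t + 1) ω))
        (Measurable.prodMk (measurable_pi_lambda _ fun i => hX i) ((hX _).prodMk (hX _)))
        (fun z => (∑ i : Fin t, φ i (z.1 i.castSucc) (z.1 i.succ)) * φ t z.2.1 z.2.2)
      simpa only [hMdef, hDdef, Finset.sum_range, Fin.val_castSucc, Fin.val_succ] using h
    have hD2 : Integrable (fun ω => D ω ^ 2) P :=
      integrable_comp_of_finite (Z := fun ω => (X t ω, X (t + 1) ω)) ((hX _).prodMk (hX _))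
        (fun z => φ t z.1 z.2 ^ 2)
    have hM2 : Integrable (fun ω => M ω ^ 2) P := integrable_sq_sum_increments hX φ t
    have hDle : ∫ ω, D ω ^ 2 ∂P ≤ P.real Set.univ * B t ^ 2 := by
      calc ∫ ω, D ω ^ 2 ∂P ≤ ∫ _, B t ^ 2 ∂P := by
            refine integral_mono hD2 (integrable_const _) fun ω => ?_
            exact sq_le_sq' (neg_le_of_abs_le (hB _ _ _)) (le_of_abs_le (hB _ _ _))
        _ = _ := by rw [integral_const, smul_eq_mul]
    calc ∫ ω, (∑ i ∈ Finset.range (t + 1), φ i (X i ω) (X (i + 1) ω)) ^ 2 ∂P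
        = ∫ ω, (M ω ^ 2 + 2 * (M ω * D ω) + D ω ^ 2) ∂P := by
          refine integral_congr_ae (ae_of_all _ fun ω => ?_)
          simp only [Finset.sum_range_succ, hMdef, hDdef]
          ring
      _ = ∫ ω, M ω ^ 2 ∂P + ∫ ω, D ω ^ 2 ∂P := by
          have hMM := hM2.add (hMD.const_mul 2)
          rw [integral_add (f := fun ω => M ω ^ 2 + 2 * (M ω * D ω)) hMM hD2,
            integral_add hM2 (hMD.const_mul 2), integral_const_mul, hcross, mul_zero, add_zero]
      _ ≤ _ := by
          rw [Finset.sum_range_succ, mul_add]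
          exact add_le_add ih hDle

end Probability

theorem two_lt_of_not_connected_supp {N : ℕ} (G : SimpleGraph (Fin N)) {μ : Fin N → ℝ}
    (hμ1 : ∑ s, μ s = 1) (hsupp : ¬ (G.induce {s : Fin N | 0 < μ s}).Connected)
    (hne : {s : Fin N | 0 < μ s} ≠ Set.univ) : 2 < N := by
  by_contra hN
  refine hsupp ?_
  obtain ⟨z, hz⟩ := (Set.ne_univ_iff_exists_notMem _).1 hne
  obtain ⟨s, -, hs⟩ := Finset.exists_lt_of_sum_lt (s := Finset.univ) (f := fun _ => (0 : ℝ)) (g := μ)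
    (by simp [hμ1])
  have : Subsingleton {s : Fin N | 0 < μ s} := by
    refine ⟨fun a b => Subtype.ext (Fin.ext ?_)⟩
    have ha : (a : Fin N) ≠ z := fun h => hz (h ▸ a.2)
    have hb : (b : Fin N) ≠ z := fun h => hz (h ▸ b.2)
    rw [Ne, Fin.ext_iff] at ha hb
    omega
  exact { preconnected := .of_subsingleton, nonempty := ⟨⟨s, hs⟩⟩ }

/-- For large `k` the Poisson equation of `P^{(μ_k,G)}` has a solution of size `O(k²)`. -/
theorem exists_poisson_solution_muk {N : ℕ} {G : SimpleGraph (Fin N)} (hG : G.Connected)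
    (hN : 2 ≤ N) {μ : Fin N → ℝ} (hμ0 : ∀ s, 0 ≤ μ s) (hμ1 : ∑ s, μ s = 1)
    (hne : {s : Fin N | 0 < μ s} ≠ Set.univ) {f : Fin N → ℝ} {F : ℝ} (hF : ∀ s, |f s| ≤ F)
    {k : ℕ} (hk : suppMinCeil μ < k) :
    ∃ g : Fin N → ℝ,
      (∀ l, g l - ∑ m, Pmat G (muk μ k) l m * g m = f l - ∑ s, f s * muk μ k s) ∧
      (∀ l, |f l - ∑ s, f s * muk μ k s| ≤ 2 * F) ∧
      ∀ l, |g l| ≤ 8 * (N : ℝ) ^ 5 * F * (k : ℝ) ^ 2 := by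
  have : Nontrivial (Fin N) := Fin.nontrivial_iff_two_le.2 hN
  have hk0 : (0 : ℝ) < k := by exact_mod_cast (Nat.zero_le _).trans_lt hk
  have hN0 : (0 : ℝ) < N := by exact_mod_cast (by omega : 0 < N)
  obtain ⟨z, hz⟩ := (Set.ne_univ_iff_exists_notMem _).1 hne
  have hA : (Ak μ k).Nonempty :=
    ⟨z, (mem_Ak_iff hμ0 hk).2 (le_antisymm (not_lt.1 hz) (hμ0 z))⟩
  have hsum : ∑ s, muk μ k s = 1 := sum_muk hμ1 (by rintro rfl; simp at hk0) hA
  have hmuk := le_muk hμ0 hk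
  have hδ : 0 < 1 / ((k : ℝ) * N) := by positivity
  set c := ∑ s, f s * muk μ k s with hc
  have hcF : |c| ≤ F := by
    calc |c| ≤ ∑ s, |f s * muk μ k s| := Finset.abs_sum_le_sum_abs _ _
      _ ≤ ∑ s, F * muk μ k s := by
          refine Finset.sum_le_sum fun s _ => ?_
          have hs : 0 ≤ muk μ k s := hδ.le.trans (hmuk s)
          rw [abs_mul, abs_of_nonneg hs]
          exact mul_le_mul_of_nonneg_right (hF s) hs
      _ = F := by rw [← Finset.mul_sum, hsum, mul_one]
  have hH : ∀ l, |f l - c| ≤ 2 * F := fun l => by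
    have := abs_sub (f l) c
    linarith [hF l]
  have hh : ∑ v, muk μ k v * (f v - c) = 0 := by
    simp only [mul_sub, Finset.sum_sub_distrib, ← Finset.sum_mul, hsum, one_mul, hc]
    rw [sub_eq_zero]
    exact Finset.sum_congr rfl fun v _ => mul_comm _ _
  obtain ⟨g, hg, hgb⟩ := exists_poisson_solution_Pmat hG hδ hmuk hsum hh hH
  refine ⟨g, hg, hH, fun l => (hgb l).trans_eq ?_⟩
  rw [Fintype.card_fin]
  field_simp
  ring

/-- A law of large numbers for Markov increments: `∑ φ_i(X_i, X_{i+1}) / t → 0` along cubes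
provided that the increments grow slowly. -/
theorem IsMarkovOn.ae_tendsto_sum_increments_cube {Ω : Type*} [MeasurableSpace Ω] {P : Measure Ω}
    [IsProbabilityMeasure P] {S : Type*} [Fintype S] [MeasurableSpace S]
    [MeasurableSingletonClass S] {X : ℕ → Ω → S} {T : ℕ → Matrix S S ℝ} (hM : IsMarkovOn P X T)
    (hX : ∀ t, Measurable (X t)) {φ : ℕ → S → S → ℝ}
    (hφ : ∀ t x, ∑ y, T t x y * φ t x y = 0) {K : ℕ → ℕ} (hK : Monotone K)
    (hKle : ∀ t, K t ^ 12 ≤ t) {C : ℝ}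
    (hB : ∀ t x y, |φ t x y| ≤ C * (K t : ℝ) ^ 2) :
    ∀ᵐ ω ∂P, Tendsto (fun j : ℕ =>
      (∑ i ∈ Finset.range (j ^ 3), φ i (X i ω) (X (i + 1) ω)) / ((j ^ 3 : ℕ) : ℝ))
      atTop (nhds 0) := by
  refine ae_tendsto_zero_of_summable_integral_sq (c := fun j : ℕ => C ^ 2 * (1 / (j : ℝ) ^ 2))
    ?_ ?_ ((Real.summable_one_div_nat_pow.2 one_lt_two).mul_left _)
  · intro j
    simp only [div_pow]
    exact (integrable_sq_sum_increments hX φ _).div_const _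
  · intro j
    rcases j.eq_zero_or_pos with rfl | hj
    · simp
    have hj0 : (0 : ℝ) < j := by exact_mod_cast hj
    have hK4 : (K (j ^ 3) : ℝ) ^ 4 ≤ j := by
      have h1 : (K (j ^ 3) ^ 4) ^ 3 ≤ j ^ 3 := by
        rw [← pow_mul]
        exact hKle _
      exact_mod_cast (Nat.pow_le_pow_iff_left (by norm_num)).1 h1
    simp only [div_pow]
    rw [integral_div, div_le_iff₀ (by positivity)]
    refine (hM.integral_sq_sum_increments_le hX hφ hB _).trans ?_
    rw [probReal_univ, one_mul]
    calc ∑ i ∈ Finset.range (j ^ 3), (C * (K i : ℝ) ^ 2) ^ 2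
        ≤ ∑ _i ∈ Finset.range (j ^ 3), C ^ 2 * (j : ℝ) := by
          refine Finset.sum_le_sum fun i hi => ?_
          have h1 : (K i : ℝ) ≤ K (j ^ 3) := by exact_mod_cast hK (Finset.mem_range.1 hi).le
          calc (C * (K i : ℝ) ^ 2) ^ 2 = C ^ 2 * (K i : ℝ) ^ 4 := by ring
            _ ≤ C ^ 2 * (K (j ^ 3) : ℝ) ^ 4 := by gcongr
            _ ≤ _ := by gcongr
      _ = C ^ 2 * (1 / (j : ℝ) ^ 2) * ((j ^ 3 : ℕ) : ℝ) ^ 2 := by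
          rw [Finset.sum_const, Finset.card_range, nsmul_eq_mul]
          push_cast
          field_simp

theorem tendsto_cube_div_of_pow_le {K : ℕ → ℕ} (hK : Tendsto K atTop atTop)
    (hKle : ∀ t, K t ^ 12 ≤ t) : Tendsto (fun t : ℕ => (K t : ℝ) ^ 3 / t) atTop (nhds 0) := by
  refine squeeze_zero' (Eventually.of_forall fun t => by positivity) ?_
    (tendsto_one_div_atTop_nhds_zero_nat.comp hK)
  filter_upwards [hK.eventually_ge_atTop 1] with t ht
  have h1 : K t ^ 4 ≤ t := (Nat.pow_le_pow_right ht (by norm_num)).trans (hKle t)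
  have h2 : (K t : ℝ) ^ 4 ≤ t := by exact_mod_cast h1
  have h3 : (0 : ℝ) < K t := by exact_mod_cast ht
  rw [Function.comp_apply, div_le_div_iff₀ (lt_of_lt_of_le (by positivity) h2) h3]
  linarith

theorem stmt_16 {N : ℕ} (G : SimpleGraph (Fin N)) (hG : G.Connected)
    (μ : Fin N → ℝ) (hμ0 : ∀ s, 0 ≤ μ s) (hμ1 : ∑ s, μ s = 1)
    (hord : ∀ l m : Fin N, l ≤ m → μ m ≤ μ l)
    (hsupp : ¬ (G.induce {s : Fin N | 0 < μ s}).Connected)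
    (hne : {s : Fin N | 0 < μ s} ≠ Set.univ)
    {Ω : Type*} [MeasurableSpace Ω] (P : Measure Ω) [IsProbabilityMeasure P]
    (X : ℕ → Ω → Fin N) (hX : ∀ t, Measurable (X t))
    (T : ℕ → Matrix (Fin N) (Fin N) ℝ)
    (hT : ∀ t k : ℕ, suppMinCeil μ < k → k ^ (5 * N) ≤ t → t < (k + 1) ^ (5 * N) →
      T t = Pmat G (muk μ k))
    (hMarkov : IsMarkovOn P X T) :
    ∀ f : Fin N → ℝ, ∀ᵐ ω ∂P,
      Tendsto (fun t : ℕ => (∑ m ∈ Finset.range t, f (X m ω)) / t)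
        atTop (nhds (∑ s, f s * μ s)) := by
  intro f
  have hN := two_lt_of_not_connected_supp G hμ1 hsupp hne
  have hd : 5 * N ≠ 0 := by omega
  set K : ℕ → ℕ := Nat.nthRoot (5 * N) with hKdef
  have hKmono : Monotone K := monotone_nthRoot hd
  have hKtop : Tendsto K atTop atTop := tendsto_nthRoot_atTop hd
  have hKpow : ∀ t, K t ^ (5 * N) ≤ t := fun t => (Nat.le_nthRoot_iff hd).1 le_rfl
  have hKle : ∀ t, K t ^ 12 ≤ t := fun t => by
    rcases (K t).eq_zero_or_pos with h | h
    · simp [h]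
    · exact (Nat.pow_le_pow_right h (by omega)).trans (hKpow t)
  have hTK : ∀ t, suppMinCeil μ < K t → T t = Pmat G (muk μ (K t)) := fun t ht =>
    hT t (K t) ht (hKpow t) (Nat.lt_pow_nthRoot_add_one hd t)
  set F : ℝ := ∑ s, |f s| with hFdef
  have hF0 : 0 ≤ F := Finset.sum_nonneg fun s _ => abs_nonneg _
  have hF : ∀ s, |f s| ≤ F := fun s =>
    Finset.single_le_sum (f := fun s => |f s|) (fun s _ => abs_nonneg _) (Finset.mem_univ s)
  set c : ℕ → ℝ := fun k => ∑ s, f s * muk μ k s with hcdef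
  set c' : ℝ := ∑ s, f s * μ s with hc'def
  have hc : Tendsto c atTop (nhds c') := tendsto_finsetSum _ fun s _ =>
    (tendsto_muk s).const_mul (f s)
  set C : ℝ := 8 * (N : ℝ) ^ 5 * F with hCdef
  have hC : 0 ≤ C := by positivity
  have hex : ∀ k, ∃ g : Fin N → ℝ,
      (suppMinCeil μ < k → (∀ l, g l - ∑ m, Pmat G (muk μ k) l m * g m = f l - c k) ∧
        ∀ l, |f l - c k| ≤ 2 * F) ∧
      (¬ suppMinCeil μ < k → g = 0) ∧ ∀ l, |g l| ≤ C * (k : ℝ) ^ 2 := by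
    intro k
    by_cases hk : suppMinCeil μ < k
    · obtain ⟨g, h1, h2, h3⟩ := exists_poisson_solution_muk hG hN.le hμ0 hμ1 hne hF hk
      exact ⟨g, fun _ => ⟨h1, h2⟩, fun h => absurd hk h, h3⟩
    · refine ⟨0, fun h => absurd h hk, fun _ => rfl, fun l => ?_⟩
      rw [Pi.zero_apply, abs_zero]
      positivity
  choose g hgP hg0 hgb using hex
  set φ : ℕ → Fin N → Fin N → ℝ := fun t x y =>
    if suppMinCeil μ < K t then g (K t) y - g (K t) x + (f x - c (K t)) else 0 with hφdef
  have hφ : ∀ t x, ∑ y, T t x y * φ t x y = 0 := by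
    intro t x
    by_cases hk : suppMinCeil μ < K t
    · have hrow := sum_Pmat_row (G := G) (ν := muk μ (K t)) x
      simp only [hφdef, if_pos hk, hTK t hk, ← (hgP _ hk).1 x, mul_add, Finset.sum_add_distrib,
        mul_sub, Finset.sum_sub_distrib, ← Finset.sum_mul, hrow]
      ring
    · simp [hφdef, hk]
  have hφb : ∀ t x y, |φ t x y| ≤ (2 * C + 2 * F) * (K t : ℝ) ^ 2 := by
    intro t x y
    by_cases hk : suppMinCeil μ < K t
    · have h1 : (1 : ℝ) ≤ (K t : ℝ) ^ 2 := one_le_pow₀ (by exact_mod_cast Nat.one_le_of_lt hk)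
      simp only [hφdef, if_pos hk]
      have h2 := abs_add_le (g (K t) y - g (K t) x) (f x - c (K t))
      have h3 := abs_sub (g (K t) y) (g (K t) x)
      have h4 := hgb (K t) y
      have h5 := hgb (K t) x
      have h6 := (hgP _ hk).2 x
      nlinarith
    · simp only [hφdef, if_neg hk, abs_zero]
      positivity
  filter_upwards [hMarkov.ae_tendsto_sum_increments_cube hX hφ hKmono hKle hφb] with ω hω
  set e : ℕ → ℝ := fun t => if suppMinCeil μ < K t then c (K t) - c' else f (X t ω) - c' with hedef
  have he : Tendsto e atTop (nhds 0) := by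
    have h1 := (hc.comp hKtop).sub_const c'
    rw [sub_self] at h1
    refine h1.congr' ?_
    filter_upwards [hKtop.eventually_gt_atTop (suppMinCeil μ)] with t ht
    simp [hedef, ht]
  have hdecomp : ∀ t, ∑ m ∈ Finset.range t, (f (X m ω) - c')
      = ∑ m ∈ Finset.range t, φ m (X m ω) (X (m + 1) ω)
        + ∑ m ∈ Finset.range t, (g (K m) (X m ω) - g (K m) (X (m + 1) ω))
        + ∑ m ∈ Finset.range t, e m := by
    intro t
    rw [← Finset.sum_add_distrib, ← Finset.sum_add_distrib]
    refine Finset.sum_congr rfl fun m _ => ?_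
    by_cases hk : suppMinCeil μ < K m
    · simp only [hφdef, hedef, if_pos hk]
      ring
    · simp [hφdef, hedef, if_neg hk, hg0 _ hk]
  have hblock : Tendsto (fun t : ℕ =>
      (∑ m ∈ Finset.range t, (g (K m) (X m ω) - g (K m) (X (m + 1) ω))) / t)
      atTop (nhds 0) := by
    have h1 := (tendsto_cube_div_of_pow_le hKtop hKle).const_mul (3 * C)
    rw [mul_zero] at h1
    refine squeeze_zero_norm (fun t => ?_) h1
    rw [Real.norm_eq_abs, abs_div, Nat.abs_cast, ← mul_div_assoc]
    gcongr
    exact abs_sum_block_sub_le hC hgb hKmono (fun m => X m ω) t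
  have hcesaro : Tendsto (fun t : ℕ => (∑ m ∈ Finset.range t, e m) / t) atTop (nhds 0) :=
    he.cesaro.congr fun t => by rw [div_eq_inv_mul]
  have hcube : Tendsto (fun j : ℕ => j ^ 3) atTop atTop := tendsto_pow_atTop (by norm_num)
  have hlim := tendsto_div_of_tendsto_div_cube
    (S := fun t => ∑ m ∈ Finset.range t, (f (X m ω) - c')) (C := F + |c'|)
    (fun n => by
      rw [Finset.sum_range_succ, add_sub_cancel_left]
      exact (abs_sub _ _).trans (add_le_add_left (hF _) _))
    (by
      have h1 := (hω.add (hblock.comp hcube)).add (hcesaro.comp hcube)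
      rw [add_zero, add_zero] at h1
      refine h1.congr fun j => ?_
      simp only [Function.comp_apply, hdecomp, add_div])
  have hfinal := hlim.add_const c'
  rw [zero_add] at hfinal
  refine hfinal.congr' ?_
  filter_upwards [eventually_ne_atTop 0] with t ht
  have : (t : ℝ) ≠ 0 := by exact_mod_cast ht
  rw [Finset.sum_sub_distrib, Finset.sum_const, Finset.card_range, nsmul_eq_mul]
  field_simp
  ring
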